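/- For every real t > 0 and every natural number m ≥ 1, (∂²J_ν(t)/∂ν²)|_{ν=m} + (−1)^{m+1}·(∂²J_ν(t)/∂ν²)|_{ν=−m} = π·m!·Σ_{k=0}^{m−1} [Y_k(t)/(k!·(m−k))]·(t/2)^{k−m}. -/

import Mathlib

open Real MeasureTheory

/-- Bessel function of the first kind via Schläfli's integral representation. -/
noncomputable def besselJ (ν t : ℝ) : ℝ :=
  (1 / π) * ∫ x in (0:ℝ)..π, Real.cos (t * Real.sin x - ν * x)
    - (Real.sin (ν * π) / π) * ∫ x in Set.Ioi (0:ℝ), Real.exp (-(t * Real.sinh x) - ν * x)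

/-- Bessel function of the second kind via its integral representation. -/
noncomputable def besselY (ν t : ℝ) : ℝ :=
  (1 / π) * ∫ x in (0:ℝ)..π, Real.sin (t * Real.sin x - ν * x)
    - (1 / π) * ∫ x in Set.Ioi (0:ℝ),
        Real.exp (-(t * Real.sinh x)) *
          (Real.exp (ν * x) + Real.exp (-(ν * x)) * Real.cos (ν * π))

/-! ### Moments of the Schläfli kernel on the half-line -/

/-- The integrand `xᵖ exp (-t sinh x - a x)`. -/
noncomputable def schlafliKernel (t : ℝ) (p : ℕ) (a x : ℝ) : ℝ :=
  x ^ p * Real.exp (-(t * Real.sinh x) - a * x)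

/-- The `p`-th moment `∫₀^∞ xᵖ exp (-t sinh x - a x) dx`. -/
noncomputable def schlafliMoment (t : ℝ) (p : ℕ) (a : ℝ) : ℝ :=
  ∫ x in Set.Ioi (0 : ℝ), schlafliKernel t p a x

lemma sq_div_four_le_sinh {x : ℝ} (hx : 0 ≤ x) : x ^ 2 / 4 ≤ Real.sinh x := by
  have h1 := Real.quadratic_le_exp_of_nonneg hx
  have h2 : Real.exp (-x) ≤ 1 := Real.exp_le_one_iff.2 (by linarith)
  rw [Real.sinh_eq]
  linarith

lemma continuous_schlafliKernel (t : ℝ) (p : ℕ) (a : ℝ) : Continuous (schlafliKernel t p a) := by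
  unfold schlafliKernel
  fun_prop

lemma schlafliKernel_nonneg (t : ℝ) (p : ℕ) (a : ℝ) {x : ℝ} (hx : 0 ≤ x) :
    0 ≤ schlafliKernel t p a x :=
  mul_nonneg (pow_nonneg hx p) (Real.exp_pos _).le

lemma schlafliKernel_le {t : ℝ} (ht : 0 < t) (p : ℕ) (a : ℝ) {x : ℝ} (hx : 0 ≤ x) :
    schlafliKernel t p a x ≤ p.factorial * Real.exp ((2 - a) ^ 2 / t) * Real.exp (-x) := by
  have h1 : x ^ p ≤ p.factorial * Real.exp x := by
    have := Real.pow_div_factorial_le_exp x hx p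
    rwa [div_le_iff₀' (by positivity)] at this
  have h2 : x + (-(t * Real.sinh x) - a * x) ≤ (2 - a) ^ 2 / t + -x := by
    have h3 : t * (x ^ 2 / 4) ≤ t * Real.sinh x :=
      mul_le_mul_of_nonneg_left (sq_div_four_le_sinh hx) ht.le
    have h4 : (2 - a) ^ 2 / t - (2 - a) * x + t * (x ^ 2 / 4) = ((2 - a) - t * x / 2) ^ 2 / t := by
      field_simp
      ring
    have h5 : 0 ≤ ((2 - a) - t * x / 2) ^ 2 / t := by positivity
    linarith
  calc schlafliKernel t p a x
      ≤ p.factorial * Real.exp x * Real.exp (-(t * Real.sinh x) - a * x) :=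
        mul_le_mul_of_nonneg_right h1 (Real.exp_pos _).le
    _ = p.factorial * Real.exp (x + (-(t * Real.sinh x) - a * x)) := by
        rw [Real.exp_add]; ring
    _ ≤ p.factorial * Real.exp ((2 - a) ^ 2 / t + -x) := by gcongr
    _ = _ := by rw [Real.exp_add]; ring

lemma integrableOn_schlafliKernel {t : ℝ} (ht : 0 < t) (p : ℕ) (a : ℝ) :
    IntegrableOn (schlafliKernel t p a) (Set.Ioi 0) := by
  refine Integrable.mono' ((integrableOn_exp_neg_Ioi 0).const_mul
    (p.factorial * Real.exp ((2 - a) ^ 2 / t)))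
    (continuous_schlafliKernel t p a).aestronglyMeasurable ?_
  filter_upwards [ae_restrict_mem measurableSet_Ioi] with x hx
  rw [Real.norm_of_nonneg (schlafliKernel_nonneg t p a (le_of_lt hx))]
  exact schlafliKernel_le ht p a (le_of_lt hx)

lemma tendsto_schlafliKernel_atTop {t : ℝ} (ht : 0 < t) (p : ℕ) (a : ℝ) :
    Filter.Tendsto (schlafliKernel t p a) Filter.atTop (nhds 0) := by
  have h : Filter.Tendsto
      (fun x : ℝ => p.factorial * Real.exp ((2 - a) ^ 2 / t) * Real.exp (-x))
      Filter.atTop (nhds 0) := by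
    simpa using (Real.tendsto_exp_neg_atTop_nhds_zero).const_mul
      (p.factorial * Real.exp ((2 - a) ^ 2 / t))
  refine tendsto_of_tendsto_of_tendsto_of_le_of_le' tendsto_const_nhds h ?_ ?_
  · filter_upwards [Filter.eventually_ge_atTop 0] with x hx
    exact schlafliKernel_nonneg t p a hx
  · filter_upwards [Filter.eventually_ge_atTop 0] with x hx
    exact schlafliKernel_le ht p a hx

lemma schlafliKernel_mul_cosh (t : ℝ) (p : ℕ) (a x : ℝ) :
    2 * Real.cosh x * schlafliKernel t p a x
      = schlafliKernel t p (a - 1) x + schlafliKernel t p (a + 1) x := by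
  have h1 : -(t * Real.sinh x) - (a - 1) * x = (-(t * Real.sinh x) - a * x) + x := by ring
  have h2 : -(t * Real.sinh x) - (a + 1) * x = (-(t * Real.sinh x) - a * x) + -x := by ring
  simp only [schlafliKernel]
  rw [Real.cosh_eq, h1, h2, Real.exp_add, Real.exp_add]
  ring

lemma hasDerivAt_schlafliKernel_zero (t a x : ℝ) :
    HasDerivAt (schlafliKernel t 0 a)
      (-a * schlafliKernel t 0 a x
        - t / 2 * (schlafliKernel t 0 (a - 1) x + schlafliKernel t 0 (a + 1) x)) x := by
  have h : HasDerivAt (fun x : ℝ => Real.exp (-(t * Real.sinh x) - a * x))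
      (Real.exp (-(t * Real.sinh x) - a * x) * (-(t * Real.cosh x) - a * 1)) x :=
    (((Real.hasDerivAt_sinh x).const_mul t).neg.sub ((hasDerivAt_id x).const_mul a)).exp
  rw [← schlafliKernel_mul_cosh]
  convert h using 1
  · ext y; simp [schlafliKernel]
  · simp only [schlafliKernel]; ring

lemma hasDerivAt_schlafliKernel_one (t a x : ℝ) :
    HasDerivAt (schlafliKernel t 1 a)
      (schlafliKernel t 0 a x - a * schlafliKernel t 1 a x
        - t / 2 * (schlafliKernel t 1 (a - 1) x + schlafliKernel t 1 (a + 1) x)) x := by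
  have h := (hasDerivAt_id x).mul (hasDerivAt_schlafliKernel_zero t a x)
  have hfun : schlafliKernel t 1 a = id * schlafliKernel t 0 a := by
    ext y
    simp [schlafliKernel]
  rw [← schlafliKernel_mul_cosh] at h ⊢
  rw [hfun]
  refine h.congr_deriv ?_
  simp only [Pi.mul_apply, id]
  ring

/-- Integration by parts for the zeroth moment. -/
lemma schlafliMoment_zero_recurrence {t : ℝ} (ht : 0 < t) (a : ℝ) :
    schlafliMoment t 0 (a - 1) + schlafliMoment t 0 (a + 1)
      = 2 / t * (1 - a * schlafliMoment t 0 a) := by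
  have i := integrableOn_schlafliKernel ht 0
  have hsum : IntegrableOn
      (fun x => schlafliKernel t 0 (a - 1) x + schlafliKernel t 0 (a + 1) x) (Set.Ioi 0) :=
    (i (a - 1)).add (i (a + 1))
  have h := integral_Ioi_of_hasDerivAt_of_tendsto'
    (fun x _ => hasDerivAt_schlafliKernel_zero t a x)
    (((i a).const_mul (-a)).sub (hsum.const_mul (t / 2)))
    (tendsto_schlafliKernel_atTop ht 0 a)
  rw [integral_sub ((i a).const_mul (-a)) (hsum.const_mul (t / 2)),
    integral_const_mul, integral_const_mul, integral_add (i (a - 1)) (i (a + 1))] at h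
  have h0 : schlafliKernel t 0 a 0 = 1 := by simp [schlafliKernel]
  rw [h0] at h
  simp only [schlafliMoment]
  field_simp
  linarith

/-- Integration by parts for the first moment. -/
lemma schlafliMoment_one_recurrence {t : ℝ} (ht : 0 < t) (a : ℝ) :
    schlafliMoment t 1 (a - 1) + schlafliMoment t 1 (a + 1)
      = 2 / t * (schlafliMoment t 0 a - a * schlafliMoment t 1 a) := by
  have i := integrableOn_schlafliKernel ht
  have hsum : IntegrableOn
      (fun x => schlafliKernel t 1 (a - 1) x + schlafliKernel t 1 (a + 1) x) (Set.Ioi 0) :=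
    (i 1 (a - 1)).add (i 1 (a + 1))
  have hdiff : IntegrableOn
      (fun x => schlafliKernel t 0 a x - a * schlafliKernel t 1 a x) (Set.Ioi 0) :=
    (i 0 a).sub ((i 1 a).const_mul a)
  have h := integral_Ioi_of_hasDerivAt_of_tendsto'
    (fun x _ => hasDerivAt_schlafliKernel_one t a x)
    (hdiff.sub (hsum.const_mul (t / 2))) (tendsto_schlafliKernel_atTop ht 1 a)
  rw [integral_sub hdiff (hsum.const_mul (t / 2)),
    integral_sub (i 0 a) ((i 1 a).const_mul a),
    integral_const_mul, integral_const_mul, integral_add (i 1 (a - 1)) (i 1 (a + 1))] at h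
  have h0 : schlafliKernel t 1 a 0 = 0 := by simp [schlafliKernel]
  rw [h0] at h
  simp only [schlafliMoment]
  field_simp
  linarith

lemma hasDerivAt_schlafliMoment {t : ℝ} (ht : 0 < t) (p : ℕ) (a : ℝ) :
    HasDerivAt (schlafliMoment t p) (-schlafliMoment t (p + 1) a) a := by
  have h := (hasDerivAt_integral_of_dominated_loc_of_deriv_le
    (μ := volume.restrict (Set.Ioi (0 : ℝ))) (F := schlafliKernel t p)
    (F' := fun b x => -schlafliKernel t (p + 1) b x) (x₀ := a)
    (bound := schlafliKernel t (p + 1) (a - 1)) (Metric.ball_mem_nhds a one_pos)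
    (Filter.Eventually.of_forall fun b => (continuous_schlafliKernel t p b).aestronglyMeasurable)
    (integrableOn_schlafliKernel ht p a)
    (continuous_schlafliKernel t (p + 1) a).neg.aestronglyMeasurable ?_
    (integrableOn_schlafliKernel ht (p + 1) (a - 1)) ?_).2
  · rwa [integral_neg] at h
  · filter_upwards [ae_restrict_mem measurableSet_Ioi] with x hx b hb
    have hx : 0 < x := hx
    rw [norm_neg, Real.norm_of_nonneg (schlafliKernel_nonneg t _ b hx.le)]
    have hb' : a - 1 ≤ b := by
      rw [Metric.mem_ball, Real.dist_eq, abs_lt] at hb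
      linarith [hb.1]
    unfold schlafliKernel
    gcongr
  · filter_upwards with x b _
    have h1 : HasDerivAt (fun b : ℝ => -(t * Real.sinh x) - b * x) (-(1 * x)) b :=
      ((hasDerivAt_id b).mul_const x).const_sub _
    refine (h1.exp.const_mul (x ^ p)).congr_deriv ?_
    simp only [schlafliKernel]
    ring

/-! ### Trigonometric integrals on `[0, π]` -/

/-- The weighted cosine integral `∫₀^π (π - 2x) cos (t sin x - a x) dx`. -/
noncomputable def skewCosIntegral (t a : ℝ) : ℝ :=
  ∫ x in (0 : ℝ)..π, (π - 2 * x) * Real.cos (t * Real.sin x - a * x)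

/-- The sine integral `∫₀^π sin (t sin x - a x) dx`. -/
noncomputable def sinIntegral (t a : ℝ) : ℝ :=
  ∫ x in (0 : ℝ)..π, Real.sin (t * Real.sin x - a * x)

lemma hasDerivAt_besselPhase (t a x : ℝ) :
    HasDerivAt (fun x : ℝ => t * Real.sin x - a * x) (t * Real.cos x - a) x :=
  (((Real.hasDerivAt_sin x).const_mul t).sub ((hasDerivAt_id x).const_mul a)).congr_deriv
    (by rw [mul_one])

lemma cos_sub_add_cos_add (c x : ℝ) :
    Real.cos (c - x) + Real.cos (c + x) = 2 * Real.cos x * Real.cos c := by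
  rw [Real.cos_sub, Real.cos_add]; ring

lemma sin_sub_add_sin_add (c x : ℝ) :
    Real.sin (c - x) + Real.sin (c + x) = 2 * Real.cos x * Real.sin c := by
  rw [Real.sin_sub, Real.sin_add]; ring

lemma skewCosIntegral_recurrence {t : ℝ} (ht : 0 < t) (a : ℝ) (ha : Real.sin (a * π) = 0) :
    skewCosIntegral t (a - 1) + skewCosIntegral t (a + 1)
      = 2 / t * (a * skewCosIntegral t a + 2 * sinIntegral t a) := by
  have hc : ∀ b : ℝ, IntervalIntegrable
      (fun x => (π - 2 * x) * Real.cos (t * Real.sin x - b * x)) volume 0 π := fun b =>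
    Continuous.intervalIntegrable (by fun_prop) _ _
  have hs : IntervalIntegrable
      (fun x => Real.sin (t * Real.sin x - a * x)) volume 0 π :=
    Continuous.intervalIntegrable (by fun_prop) _ _
  have hI := ((((hc (a - 1)).add (hc (a + 1))).const_mul (t / 2)).sub
    ((hc a).const_mul a)).sub (hs.const_mul 2)
  have h := intervalIntegral.integral_eq_sub_of_hasDerivAt (a := 0) (b := π)
    (f := fun x => (π - 2 * x) * Real.sin (t * Real.sin x - a * x)) (fun x _ => ?_) hI
  · rw [intervalIntegral.integral_sub ((((hc (a - 1)).add (hc (a + 1))).const_mul (t / 2)).sub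
      ((hc a).const_mul a)) (hs.const_mul 2),
      intervalIntegral.integral_sub (((hc (a - 1)).add (hc (a + 1))).const_mul (t / 2))
      ((hc a).const_mul a), intervalIntegral.integral_const_mul,
      intervalIntegral.integral_const_mul, intervalIntegral.integral_const_mul,
      intervalIntegral.integral_add (hc (a - 1)) (hc (a + 1))] at h
    simp only [Real.sin_pi, Real.sin_zero, mul_zero, zero_sub, Real.sin_neg, ha, sub_self,
      neg_zero] at h
    change t / 2 * (skewCosIntegral t (a - 1) + skewCosIntegral t (a + 1))
      - a * skewCosIntegral t a - 2 * sinIntegral t a = 0 at h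
    field_simp at h ⊢
    linarith
  · have h1 : HasDerivAt (fun x : ℝ => π - 2 * x) (-(2 * 1)) x :=
      ((hasDerivAt_id x).const_mul 2).const_sub π
    refine (h1.mul (hasDerivAt_besselPhase t a x).sin).congr_deriv ?_
    have h2 := cos_sub_add_cos_add (t * Real.sin x - a * x) x
    rw [show t * Real.sin x - (a - 1) * x = t * Real.sin x - a * x + x by ring,
      show t * Real.sin x - (a + 1) * x = t * Real.sin x - a * x - x by ring]
    linear_combination -(π - 2 * x) * (t / 2) * h2

lemma sinIntegral_recurrence {t : ℝ} (ht : 0 < t) (a : ℝ) :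
    sinIntegral t (a - 1) + sinIntegral t (a + 1)
      = 2 / t * (a * sinIntegral t a + 1 - Real.cos (a * π)) := by
  have hs : ∀ b : ℝ, IntervalIntegrable
      (fun x => Real.sin (t * Real.sin x - b * x)) volume 0 π := fun b =>
    Continuous.intervalIntegrable (by fun_prop) _ _
  have hI := (((hs (a - 1)).add (hs (a + 1))).const_mul (t / 2)).sub ((hs a).const_mul a)
  have h := intervalIntegral.integral_eq_sub_of_hasDerivAt (a := 0) (b := π)
    (f := fun x => -Real.cos (t * Real.sin x - a * x)) (fun x _ => ?_) hI
  · rw [intervalIntegral.integral_sub (((hs (a - 1)).add (hs (a + 1))).const_mul (t / 2))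
      ((hs a).const_mul a), intervalIntegral.integral_const_mul,
      intervalIntegral.integral_const_mul,
      intervalIntegral.integral_add (hs (a - 1)) (hs (a + 1))] at h
    simp only [Real.sin_pi, Real.sin_zero, mul_zero, zero_sub, Real.cos_neg, sub_self,
      Real.cos_zero] at h
    change t / 2 * (sinIntegral t (a - 1) + sinIntegral t (a + 1)) - a * sinIntegral t a
      = _ at h
    field_simp at h ⊢
    linarith
  · refine (hasDerivAt_besselPhase t a x).cos.neg.congr_deriv ?_
    have h2 := sin_sub_add_sin_add (t * Real.sin x - a * x) x
    rw [show t * Real.sin x - (a - 1) * x = t * Real.sin x - a * x + x by ring,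
      show t * Real.sin x - (a + 1) * x = t * Real.sin x - a * x - x by ring]
    linear_combination -(t / 2) * h2

/-- Under `x ↦ π - x` the phase of order `-m` becomes that of order `m`, up to the sign `(-1)ᵐ`. -/
lemma cos_besselPhase_reflect (t : ℝ) (m : ℕ) (x : ℝ) :
    Real.cos (t * Real.sin (π - x) - -(m : ℝ) * (π - x))
      = (-1) ^ m * Real.cos (t * Real.sin x - m * x) := by
  rw [Real.sin_pi_sub, show t * Real.sin x - -(m : ℝ) * (π - x)
    = t * Real.sin x - m * x + m * π by ring, Real.cos_add_nat_mul_pi]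

lemma skewCosIntegral_neg (t : ℝ) (m : ℕ) :
    skewCosIntegral t (-m) = -(-1) ^ m * skewCosIntegral t m := by
  have h := intervalIntegral.integral_comp_sub_left (a := 0) (b := π)
    (fun x => (π - 2 * x) * Real.cos (t * Real.sin x - -(m : ℝ) * x)) π
  rw [sub_self, sub_zero] at h
  rw [skewCosIntegral, skewCosIntegral, ← h, ← intervalIntegral.integral_const_mul]
  congr 1 with x
  rw [cos_besselPhase_reflect]
  ring

/-! ### Second derivative in the order -/

lemma hasDerivAt_integral_cos_besselPhase (t a : ℝ) :
    HasDerivAt (fun ν : ℝ => ∫ x in (0 : ℝ)..π, Real.cos (t * Real.sin x - ν * x))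
      (∫ x in (0 : ℝ)..π, x * Real.sin (t * Real.sin x - a * x)) a := by
  refine (intervalIntegral.hasDerivAt_integral_of_dominated_loc_of_deriv_le
    (F := fun ν x => Real.cos (t * Real.sin x - ν * x))
    (F' := fun ν x => x * Real.sin (t * Real.sin x - ν * x))
    (bound := fun x => |x|) Filter.univ_mem
    (Filter.Eventually.of_forall fun ν => Continuous.aestronglyMeasurable (by fun_prop))
    (Continuous.intervalIntegrable (by fun_prop) _ _)
    (Continuous.aestronglyMeasurable (by fun_prop)) ?_
    (Continuous.intervalIntegrable (by fun_prop) _ _) ?_).2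
  · refine Filter.Eventually.of_forall fun x _ ν _ => ?_
    rw [norm_mul, Real.norm_eq_abs, Real.norm_eq_abs]
    exact mul_le_of_le_one_right (abs_nonneg x) (Real.abs_sin_le_one _)
  · refine Filter.Eventually.of_forall fun x _ ν _ => ?_
    have h1 : HasDerivAt (fun b : ℝ => t * Real.sin x - b * x) (-(1 * x)) ν :=
      ((hasDerivAt_id ν).mul_const x).const_sub _
    exact h1.cos.congr_deriv (by ring)

lemma hasDerivAt_integral_mul_sin_besselPhase (t a : ℝ) :
    HasDerivAt (fun ν : ℝ => ∫ x in (0 : ℝ)..π, x * Real.sin (t * Real.sin x - ν * x))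
      (-∫ x in (0 : ℝ)..π, x ^ 2 * Real.cos (t * Real.sin x - a * x)) a := by
  rw [← intervalIntegral.integral_neg]
  refine (intervalIntegral.hasDerivAt_integral_of_dominated_loc_of_deriv_le
    (F := fun ν x => x * Real.sin (t * Real.sin x - ν * x))
    (F' := fun ν x => -(x ^ 2 * Real.cos (t * Real.sin x - ν * x)))
    (bound := fun x => x ^ 2) Filter.univ_mem
    (Filter.Eventually.of_forall fun ν => Continuous.aestronglyMeasurable (by fun_prop))
    (Continuous.intervalIntegrable (by fun_prop) _ _)
    (Continuous.aestronglyMeasurable (by fun_prop)) ?_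
    (Continuous.intervalIntegrable (by fun_prop) _ _) ?_).2
  · refine Filter.Eventually.of_forall fun x _ ν _ => ?_
    rw [norm_neg, norm_mul, Real.norm_of_nonneg (sq_nonneg x), Real.norm_eq_abs]
    exact mul_le_of_le_one_right (sq_nonneg x) (Real.abs_cos_le_one _)
  · refine Filter.Eventually.of_forall fun x _ ν _ => ?_
    have h1 : HasDerivAt (fun b : ℝ => t * Real.sin x - b * x) (-(1 * x)) ν :=
      ((hasDerivAt_id ν).mul_const x).const_sub _
    exact (h1.sin.const_mul x).congr_deriv (by ring)

lemma hasDerivAt_sin_mul_pi (a : ℝ) :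
    HasDerivAt (fun ν : ℝ => Real.sin (ν * π)) (Real.cos (a * π) * π) a := by
  simpa using ((hasDerivAt_id a).mul_const π).sin

lemma hasDerivAt_cos_mul_pi (a : ℝ) :
    HasDerivAt (fun ν : ℝ => Real.cos (ν * π)) (-Real.sin (a * π) * π) a := by
  simpa using ((hasDerivAt_id a).mul_const π).cos

lemma besselJ_eq_schlafliMoment (ν t : ℝ) :
    besselJ ν t = (1 / π) * (∫ x in (0 : ℝ)..π, Real.cos (t * Real.sin x - ν * x))
      - (1 / π) * (Real.sin (ν * π) * schlafliMoment t 0 ν) := by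
  simp only [besselJ, schlafliMoment, schlafliKernel, pow_zero, one_mul]
  rw [intervalIntegral.integral_sub (Continuous.intervalIntegrable (by fun_prop) _ _)
    intervalIntegrable_const, intervalIntegral.integral_const, smul_eq_mul, sub_zero]
  field_simp

/-- The second derivative of `ν ↦ J_ν(t)` at a zero of `sin (νπ)`. -/
lemma iteratedDeriv_two_besselJ {t : ℝ} (ht : 0 < t) (a : ℝ) (ha : Real.sin (a * π) = 0) :
    iteratedDeriv 2 (fun ν : ℝ => besselJ ν t) a
      = -(1 / π) * (∫ x in (0 : ℝ)..π, x ^ 2 * Real.cos (t * Real.sin x - a * x))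
        + 2 * Real.cos (a * π) * schlafliMoment t 1 a := by
  have h1 : deriv (fun ν : ℝ => besselJ ν t) = fun ν =>
      (1 / π) * (∫ x in (0 : ℝ)..π, x * Real.sin (t * Real.sin x - ν * x))
        - (1 / π) * (Real.cos (ν * π) * π * schlafliMoment t 0 ν
          + Real.sin (ν * π) * -schlafliMoment t 1 ν) := by
    funext ν
    simp only [besselJ_eq_schlafliMoment]
    exact (((hasDerivAt_integral_cos_besselPhase t ν).const_mul (1 / π)).sub
      (((hasDerivAt_sin_mul_pi ν).mul (hasDerivAt_schlafliMoment ht 0 ν)).const_mul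
        (1 / π))).deriv
  have h2 := ((hasDerivAt_integral_mul_sin_besselPhase t a).const_mul (1 / π)).sub
    (((((hasDerivAt_cos_mul_pi a).mul_const π).mul (hasDerivAt_schlafliMoment ht 0 a)).add
      ((hasDerivAt_sin_mul_pi a).mul (hasDerivAt_schlafliMoment ht 1 a).neg)).const_mul (1 / π))
  rw [iteratedDeriv_succ, iteratedDeriv_one, h1]
  refine h2.deriv.trans ?_
  simp only [ha, zero_add, Pi.neg_apply]
  generalize ∫ x in (0 : ℝ)..π, x ^ 2 * Real.cos (t * Real.sin x - a * x) = c
  field_simp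
  ring

/-- The reflected combination of second order-derivatives as a single pair of integrals. -/
lemma reflection_iteratedDeriv_two_besselJ {t : ℝ} (ht : 0 < t) (m : ℕ) :
    iteratedDeriv 2 (fun ν : ℝ => besselJ ν t) m
      + (-1 : ℝ) ^ (m + 1) * iteratedDeriv 2 (fun ν : ℝ => besselJ ν t) (-(m : ℝ))
      = skewCosIntegral t m
        - 2 * (schlafliMoment t 1 (-m) - (-1) ^ m * schlafliMoment t 1 m) := by
  have hcos : Real.cos (m * π) = (-1) ^ m := Real.cos_nat_mul_pi m
  have hsq : ((-1 : ℝ) ^ m) * (-1) ^ m = 1 := by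
    rw [← mul_pow]; simp
  have hrefl : ∫ x in (0 : ℝ)..π, x ^ 2 * Real.cos (t * Real.sin x - -(m : ℝ) * x)
      = (-1) ^ m * ∫ x in (0 : ℝ)..π, (π - x) ^ 2 * Real.cos (t * Real.sin x - m * x) := by
    have h := intervalIntegral.integral_comp_sub_left (a := 0) (b := π)
      (fun x => x ^ 2 * Real.cos (t * Real.sin x - -(m : ℝ) * x)) π
    rw [sub_self, sub_zero] at h
    rw [← h, ← intervalIntegral.integral_const_mul]
    congr 1 with x
    rw [cos_besselPhase_reflect]
    ring
  have hskew : π * skewCosIntegral t m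
      = (∫ x in (0 : ℝ)..π, (π - x) ^ 2 * Real.cos (t * Real.sin x - m * x))
        - ∫ x in (0 : ℝ)..π, x ^ 2 * Real.cos (t * Real.sin x - m * x) := by
    rw [skewCosIntegral, ← intervalIntegral.integral_const_mul,
      ← intervalIntegral.integral_sub (Continuous.intervalIntegrable (by fun_prop) _ _)
        (Continuous.intervalIntegrable (by fun_prop) _ _)]
    congr 1 with x
    ring
  rw [iteratedDeriv_two_besselJ ht m (Real.sin_nat_mul_pi m),
    iteratedDeriv_two_besselJ ht (-m) (by rw [neg_mul, Real.sin_neg, Real.sin_nat_mul_pi, neg_zero]),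
    neg_mul (m : ℝ) π, Real.cos_neg, hcos, hrefl, pow_succ]
  have hskew' : skewCosIntegral t m = 1 / π * (π * skewCosIntegral t m) := by
    field_simp
  rw [hskew', hskew]
  linear_combination
    (1 / π * (∫ x in (0 : ℝ)..π, (π - x) ^ 2 * Real.cos (t * Real.sin x - m * x))
      - 2 * schlafliMoment t 1 (-m)) * hsq

/-! ### Recurrences in the order -/

lemma pi_mul_besselY_nat {t : ℝ} (ht : 0 < t) (m : ℕ) :
    π * besselY m t = sinIntegral t m
      - (schlafliMoment t 0 (-m) + (-1) ^ m * schlafliMoment t 0 m) := by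
  have h : (∫ x in Set.Ioi (0 : ℝ), Real.exp (-(t * Real.sinh x)) *
      (Real.exp (m * x) + Real.exp (-(m * x)) * Real.cos (m * π)))
      = schlafliMoment t 0 (-m) + (-1) ^ m * schlafliMoment t 0 m := by
    have i := integrableOn_schlafliKernel ht 0
    rw [schlafliMoment, schlafliMoment, ← integral_const_mul,
      ← integral_add (i (-m)) ((i m).const_mul _), Real.cos_nat_mul_pi]
    congr 1 with x
    simp only [schlafliKernel, sub_eq_add_neg, Real.exp_add, neg_mul, neg_neg]
    ring
  rw [besselY, h, sinIntegral,
    intervalIntegral.integral_sub (Continuous.intervalIntegrable (by fun_prop) _ _)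
    intervalIntegrable_const, intervalIntegral.integral_const, smul_eq_mul, sub_zero]
  field_simp

lemma besselY_nat_recurrence {t : ℝ} (ht : 0 < t) (k : ℕ) :
    besselY (k + 2 : ℕ) t + besselY k t = (k + 1) * (2 / t) * besselY (k + 1 : ℕ) t := by
  have hs := sinIntegral_recurrence ht (k + 1 : ℕ)
  have hp := schlafliMoment_zero_recurrence ht (k + 1 : ℕ)
  have hn := schlafliMoment_zero_recurrence ht (-(k + 1 : ℕ))
  rw [Real.cos_nat_mul_pi] at hs
  have e1 : ((k + 1 : ℕ) : ℝ) - 1 = k := by push_cast; ring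
  have e2 : ((k + 1 : ℕ) : ℝ) + 1 = (k + 2 : ℕ) := by push_cast; ring
  have e3 : -((k + 1 : ℕ) : ℝ) - 1 = -(k + 2 : ℕ) := by push_cast; ring
  have e4 : -((k + 1 : ℕ) : ℝ) + 1 = -k := by push_cast; ring
  rw [e1, e2] at hs hp
  rw [e3, e4] at hn
  refine mul_left_cancel₀ Real.pi_ne_zero ?_
  rw [mul_add, mul_left_comm, pi_mul_besselY_nat ht, pi_mul_besselY_nat ht,
    pi_mul_besselY_nat ht]
  rw [pow_succ] at hs
  rw [show (-1 : ℝ) ^ (k + 2) = (-1) ^ k by rw [pow_add]; norm_num, pow_succ]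
  push_cast at *
  linear_combination hs - hn - (-1) ^ k * hp

lemma reflection_recurrence {t : ℝ} (ht : 0 < t) {S : ℕ → ℝ}
    (hS : ∀ m : ℕ, S m = skewCosIntegral t m
      - 2 * (schlafliMoment t 1 (-m) - (-1) ^ m * schlafliMoment t 1 m)) (k : ℕ) :
    S (k + 2) + S k
      = (k + 1) * (2 / t) * S (k + 1) + 2 * (2 / t) * (π * besselY (k + 1 : ℕ) t) := by
  have hs := skewCosIntegral_recurrence ht (k + 1 : ℕ) (Real.sin_nat_mul_pi _)
  have hp := schlafliMoment_one_recurrence ht (k + 1 : ℕ)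
  have hn := schlafliMoment_one_recurrence ht (-(k + 1 : ℕ))
  have e1 : ((k + 1 : ℕ) : ℝ) - 1 = k := by push_cast; ring
  have e2 : ((k + 1 : ℕ) : ℝ) + 1 = (k + 2 : ℕ) := by push_cast; ring
  have e3 : -((k + 1 : ℕ) : ℝ) - 1 = -(k + 2 : ℕ) := by push_cast; ring
  have e4 : -((k + 1 : ℕ) : ℝ) + 1 = -k := by push_cast; ring
  rw [e1, e2] at hs hp
  rw [e3, e4] at hn
  rw [pi_mul_besselY_nat ht, hS, hS, hS]
  rw [show (-1 : ℝ) ^ (k + 2) = (-1) ^ k by rw [pow_add]; norm_num, pow_succ]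
  push_cast at *
  linear_combination hs - 2 * hn + 2 * (-1) ^ k * hp

lemma reflection_one {t : ℝ} (ht : 0 < t) :
    skewCosIntegral t (1 : ℕ)
      - 2 * (schlafliMoment t 1 (-(1 : ℕ)) - (-1) ^ 1 * schlafliMoment t 1 (1 : ℕ))
      = 2 / t * (π * besselY (0 : ℕ) t) := by
  have hs := skewCosIntegral_recurrence ht 0 (by simp)
  have hp := schlafliMoment_one_recurrence ht 0
  have hr := skewCosIntegral_neg t 1
  rw [pi_mul_besselY_nat ht]
  norm_num at *
  rw [hr] at hs
  linear_combination hs / 2 - 2 * hp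

/-! ### The finite sum -/

/-- The sum `∑_{k<m} m! / (k! (m-k)) y_k u^{m-k}`. -/
noncomputable def factorialSum (u : ℝ) (y : ℕ → ℝ) (m : ℕ) : ℝ :=
  ∑ k ∈ Finset.range m, (m.factorial : ℝ) / (k.factorial * ((m : ℝ) - k)) * u ^ (m - k) * y k

/-- If `y` solves the homogeneous three-term recurrence, `factorialSum u y` solves it with
source term `2 u y`. -/
lemma factorialSum_recurrence (u : ℝ) (y : ℕ → ℝ)
    (hy : ∀ k : ℕ, y (k + 2) + y k = (k + 1) * u * y (k + 1)) (n : ℕ) :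
    factorialSum u y (n + 2) + factorialSum u y n
      = (n + 1) * u * factorialSum u y (n + 1) + 2 * u * y (n + 1) := by
  have hα : ∑ j ∈ Finset.range n,
        (n.factorial : ℝ) / (j.factorial * ((n : ℝ) - j)) * u ^ (n - j) * y (j + 2)
      = ∑ k ∈ Finset.range (n + 2), (n.factorial : ℝ) * (k * (k - 1))
          / (k.factorial * ((n : ℝ) + 2 - k)) * u ^ (n + 2 - k) * y k := by
    rw [Finset.sum_range_succ', Finset.sum_range_succ']
    simp only [Nat.cast_zero, zero_add, Nat.cast_one, sub_self, mul_zero, zero_mul, zero_div,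
      add_zero]
    refine Finset.sum_congr rfl fun j hj => ?_
    have hj' : (n : ℝ) - j ≠ 0 := sub_ne_zero.2 (by exact_mod_cast (Finset.mem_range.1 hj).ne')
    rw [show n + 2 - (j + 1 + 1) = n - j by omega, Nat.factorial_succ, Nat.factorial_succ]
    push_cast
    rw [show (n : ℝ) + 2 - (j + 1 + 1) = n - j by ring]
    have h1 : (j : ℝ) + 1 ≠ 0 := by positivity
    have h2 : (j : ℝ) + 1 + 1 ≠ 0 := by positivity
    field_simp
    ring
  have hβ : ∑ j ∈ Finset.range n, (n.factorial : ℝ) / (j.factorial * ((n : ℝ) - j))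
        * u ^ (n - j) * ((j + 1) * u * y (j + 1))
      = ∑ k ∈ Finset.range (n + 1), (n.factorial : ℝ) * k ^ 2
          / (k.factorial * ((n : ℝ) + 1 - k)) * u ^ (n + 2 - k) * y k := by
    rw [Finset.sum_range_succ']
    simp only [Nat.cast_zero, ne_eq, OfNat.ofNat_ne_zero, not_false_eq_true, zero_pow, mul_zero,
      zero_mul, zero_div, add_zero]
    refine Finset.sum_congr rfl fun j hj => ?_
    have hjn := Finset.mem_range.1 hj
    have hj' : (n : ℝ) - j ≠ 0 := sub_ne_zero.2 (by exact_mod_cast hjn.ne')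
    rw [show n + 2 - (j + 1) = n - j + 1 by omega, Nat.factorial_succ, pow_succ]
    push_cast
    rw [show (n : ℝ) + 1 - (j + 1) = n - j by ring]
    have h1 : (j : ℝ) + 1 ≠ 0 := by positivity
    field_simp
    ring
  have h0 : factorialSum u y n
      = ∑ j ∈ Finset.range n, (n.factorial : ℝ) / (j.factorial * ((n : ℝ) - j))
          * u ^ (n - j) * ((j + 1) * u * y (j + 1))
        - ∑ j ∈ Finset.range n,
          (n.factorial : ℝ) / (j.factorial * ((n : ℝ) - j)) * u ^ (n - j) * y (j + 2) := by
    rw [← Finset.sum_sub_distrib, factorialSum]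
    refine Finset.sum_congr rfl fun j _ => ?_
    rw [← hy j]
    ring
  have hmid : ∑ k ∈ Finset.range (n + 1), (((n + 2).factorial : ℝ)
        / (k.factorial * ((n + 2 : ℕ) - (k : ℝ))) * u ^ (n + 2 - k) * y k
        + (n.factorial : ℝ) * k ^ 2
          / (k.factorial * ((n : ℝ) + 1 - k)) * u ^ (n + 2 - k) * y k)
      = ∑ k ∈ Finset.range (n + 1), ((n + 1) * u * (((n + 1).factorial : ℝ)
        / (k.factorial * ((n + 1 : ℕ) - (k : ℝ))) * u ^ (n + 1 - k) * y k)
        + (n.factorial : ℝ) * (k * (k - 1))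
          / (k.factorial * ((n : ℝ) + 2 - k)) * u ^ (n + 2 - k) * y k) := by
    refine Finset.sum_congr rfl fun k hk => ?_
    have hkn : k < n + 1 := Finset.mem_range.1 hk
    have hkn' : (k : ℝ) < n + 1 := by exact_mod_cast hkn
    rw [show n + 2 - k = n + 1 - k + 1 by omega, pow_succ, Nat.factorial_succ (n + 1),
      Nat.factorial_succ n]
    push_cast
    have h1 : (n : ℝ) + 1 - k ≠ 0 := by linarith
    have h2 : (n : ℝ) + 2 - k ≠ 0 := by linarith
    field_simp
    ring
  have hlast : ((n + 2).factorial : ℝ) / ((n + 1).factorial * ((n + 2 : ℕ) - ((n + 1 : ℕ) : ℝ)))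
      * u ^ (n + 2 - (n + 1)) * y (n + 1)
      = (n.factorial : ℝ) * ((n + 1 : ℕ) * ((n + 1 : ℕ) - 1))
          / ((n + 1).factorial * ((n : ℝ) + 2 - (n + 1 : ℕ))) * u ^ (n + 2 - (n + 1)) * y (n + 1)
        + 2 * u * y (n + 1) := by
    rw [show n + 2 - (n + 1) = 1 by omega, Nat.factorial_succ (n + 1), Nat.factorial_succ n]
    push_cast
    have h1 : (n : ℝ) + 1 ≠ 0 := by positivity
    rw [show (n : ℝ) + 2 - (n + 1) = 1 by ring]
    field_simp
    ring
  rw [h0, hα, hβ, factorialSum, factorialSum, Finset.sum_range_succ (n := n + 1),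
    Finset.sum_range_succ (n := n + 1), Finset.mul_sum]
  rw [Finset.sum_add_distrib, Finset.sum_add_distrib] at hmid
  linear_combination hmid + hlast

theorem reflection_second_deriv_besselJ_closed_form (t : ℝ) (ht : 0 < t) (m : ℕ) (hm : 1 ≤ m) :
    iteratedDeriv 2 (fun ν : ℝ => besselJ ν t) m
      + (-1 : ℝ) ^ (m + 1) * iteratedDeriv 2 (fun ν : ℝ => besselJ ν t) (-(m : ℝ))
      = π * (m.factorial : ℝ) *
          ∑ k ∈ Finset.range m,
            besselY k t / ((k.factorial : ℝ) * ((m : ℝ) - k)) * (t / 2) ^ ((k : ℤ) - (m : ℤ)) := by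
  have key : ∀ m : ℕ, skewCosIntegral t m
      - 2 * (schlafliMoment t 1 (-m) - (-1) ^ m * schlafliMoment t 1 m)
      = π * factorialSum (2 / t) (fun k => besselY k t) m := by
    intro m
    induction m using Nat.twoStepInduction with
    | zero =>
      have h := skewCosIntegral_neg t 0
      norm_num at h
      have h0 : skewCosIntegral t 0 = 0 := by linarith
      simp [factorialSum, h0]
    | one =>
      rw [reflection_one ht]
      simp [factorialSum]
      ring
    | more k ih1 ih2 =>
      have h := reflection_recurrence ht (S := fun m => skewCosIntegral t m
        - 2 * (schlafliMoment t 1 (-m) - (-1) ^ m * schlafliMoment t 1 m)) (fun _ => rfl) k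
      have hY := factorialSum_recurrence (2 / t) (fun k => besselY k t)
        (besselY_nat_recurrence ht) k
      rw [ih1, ih2] at h
      linear_combination h - π * hY
  rw [reflection_iteratedDeriv_two_besselJ ht, key, factorialSum, mul_assoc]
  congr 1
  rw [Finset.mul_sum]
  refine Finset.sum_congr rfl fun k hk => ?_
  have hkm : k ≤ m := (Finset.mem_range.1 hk).le
  have hpow : (t / 2) ^ ((k : ℤ) - (m : ℤ)) = (2 / t) ^ (m - k) := by
    rw [← zpow_natCast, Nat.cast_sub hkm, ← inv_div, inv_zpow', neg_sub]
  rw [hpow]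
  ring
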